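/- arXiv:2111.12312 — 2 statements merged into one kernel-verified Lean document; each statement's English description precedes it below -/
import Mathlib

section
/- Let S = T ⊆ ℝ^d be Borel, let ω be a metric on ℝ^d, let k ∈ (0,∞), and consider the distortion function ρ(x,y) = ω(x,y)^k on S×S. Let X be a random variable taking values in S, and suppose there exists a probability measure ν on S with ν ≪ μ_X and ‖dν/dμ_X‖_∞^{(μ_X)} < ∞. Suppose ν is ρ^{1/k}-superregular of dimension m ∈ (k,∞) with superregularity constants b ∈ (0,∞) and δ₀ ∈ (0,∞], and assume sup_{x,y∈S} ω(x,y) < ∞ whenever δ₀ < ∞. Then: (i) limsup_{n→∞} n^{k/m}·V_n(X) ≤ Ω_{k/m}(X)·Γ(1+k/m)·b^{-k/m}, where Ω_α(X) = E[((dν/dμ_X)(X))^α]; (ii) Ω_α(X) ≤ 1 for all α ∈ (0,1), with strict inequality unless (dν/dμ_X)(x) = 1 for ν-almost all x ∈ S; and (iii) if the k-th quantization dimension D_k(X) exists and equals m, then the upper k-th quantization coefficient satisfies C̄_k(X) ≤ Ω_{k/m}(X)·Γ(1+k/m)·b^{-k/m}. -/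
open MeasureTheory Filter
open scoped ENNReal Classical

/-- The `n`-th quantization error `V_n(X) = inf_f E[ρ(X, f(X))]`, the infimum being over
all measurable maps `f : X → Y` whose range contains at most `n` points. -/
noncomputable def quantErr {X Y : Type*} [MeasurableSpace X] [MeasurableSpace Y]
    (μX : Measure X) (ρ : X → Y → ℝ≥0∞) (n : ℕ) : ℝ≥0∞ :=
  ⨅ (f : X → Y)
    (_ : Measurable f ∧ ∃ s : Finset Y, s.card ≤ n ∧ ∀ x, f x ∈ s),
    ∫⁻ x, ρ x (f x) ∂μX

/-- The quantity `k·log n / log(1/V_n(X))`, whose `liminf`/`limsup` as `n → ∞` are the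
lower/upper `k`-th quantization dimensions. -/
noncomputable def qRatio {X Y : Type*} [MeasurableSpace X] [MeasurableSpace Y]
    (μX : Measure X) (ρ : X → Y → ℝ≥0∞) (k : ℝ) (n : ℕ) : ℝ :=
  k * Real.log n / Real.log (1 / (quantErr μX ρ n).toReal)

theorem secondCountableTopology_of_measure_ball_pos {E : Type*} [PseudoMetricSpace E]
    [MeasurableSpace E] (ν : Measure E) [IsFiniteMeasure ν]
    (hball : ∀ (x : E) (r : ℝ), MeasurableSet (Metric.ball x r))
    (hpos : ∀ (x : E) (r : ℝ), 0 < r → 0 < ν (Metric.ball x r)) :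
    SecondCountableTopology E := by
  refine Metric.secondCountable_of_almost_dense_set fun ε hε => ?_
  obtain ⟨s, hs⟩ := zorn_subset {s : Set E | s.Pairwise fun x y => ε < dist x y} (by
    intro c hc hchain
    refine ⟨⋃₀ c, ?_, fun s hs => Set.subset_sUnion_of_mem hs⟩
    exact (Set.pairwise_sUnion hchain.directedOn).2 fun s hs => hc hs)
  refine ⟨s, ?_, fun x => ?_⟩
  · have hcount := Measure.countable_meas_pos_of_disjoint_iUnion (μ := ν)
      (As := fun i : s => Metric.ball (i : E) (ε / 2)) (fun i => hball _ _) (by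
        intro i j hij
        refine Metric.ball_disjoint_ball ?_
        have := hs.prop i.2 j.2 (fun h => hij (Subtype.ext h))
        linarith)
    have huniv : {i : s | 0 < ν (Metric.ball (i : E) (ε / 2))} = Set.univ :=
      Set.eq_univ_of_forall fun i => hpos _ _ (by positivity)
    rw [huniv, Set.countable_univ_iff] at hcount
    exact Set.countable_coe_iff.1 hcount
  · by_contra! hx
    have hins : insert x s ∈ {s : Set E | s.Pairwise fun x y => ε < dist x y} := by
      refine hs.prop.insert fun y hy _ => ⟨hx y hy, ?_⟩
      rw [dist_comm]
      exact hx y hy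
    have hmem : x ∈ s := hs.le_of_ge hins (Set.subset_insert x s) (Set.mem_insert x s)
    have := hx x hmem
    rw [dist_self] at this
    linarith

theorem borelSpace_of_measurableSet_ball {E : Type*} [MetricSpace E] [MeasurableSpace E]
    [StandardBorelSpace E] [SecondCountableTopology E]
    (hball : ∀ (x : E) (r : ℝ), MeasurableSet (Metric.ball x r)) : BorelSpace E := by
  have hle : borel E ≤ ‹MeasurableSpace E› := by
    refine MeasurableSpace.generateFrom_le fun U hU => ?_
    obtain ⟨T, hTU, hT, hTeq⟩ := TopologicalSpace.isOpen_biUnion_countable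
      {p : E × ℝ | Metric.ball p.1 p.2 ⊆ U} (fun p => Metric.ball p.1 p.2)
      (fun p _ => Metric.isOpen_ball)
    have hU' : U = ⋃ p ∈ {p : E × ℝ | Metric.ball p.1 p.2 ⊆ U}, Metric.ball p.1 p.2 := by
      refine Set.Subset.antisymm (fun x hx => ?_) (Set.iUnion₂_subset fun p hp => hp)
      obtain ⟨r, hr, hrU⟩ := Metric.isOpen_iff.1 hU x hx
      exact Set.mem_biUnion (show (x, r) ∈ {p : E × ℝ | Metric.ball p.1 p.2 ⊆ U} from hrU)
        (Metric.mem_ball_self hr)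
    rw [hU', ← hTeq]
    exact MeasurableSet.biUnion hT fun p _ => hball _ _
  refine ⟨le_antisymm (fun s hs => ?_) hle⟩
  have hsep : ∀ m : MeasurableSpace E, m = borel E →
      @MeasurableSpace.CountablySeparated E m := fun m hm => by
    have : BorelSpace E := ⟨hm⟩
    infer_instance
  have hemb := @Measurable.measurableEmbedding E E (borel E) id (hsep _ rfl) ‹_› ‹_›
    (measurable_id'' hle) Function.injective_id
  simpa using @MeasurableEmbedding.measurableSet_image' E E _ (borel E) id hemb s hs

theorem lintegral_exp_neg_mul_rpow {p c : ℝ} (hp : 0 < p) (hc : 0 < c) :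
    ∫⁻ s in Set.Ioi (0 : ℝ), ENNReal.ofReal (Real.exp (-c * s ^ p)) =
      ENNReal.ofReal (c ^ (-1 / p) * Real.Gamma (1 / p + 1)) := by
  rw [← integral_exp_neg_mul_rpow hp hc, ofReal_integral_eq_lintegral_ofReal]
  · simpa [IntegrableOn] using integrableOn_rpow_mul_exp_neg_mul_rpow (s := 0) (by norm_num) hp hc
  · exact Eventually.of_forall fun _ => (Real.exp_pos _).le

theorem ofReal_exp_pow (a : ℝ) (n : ℕ) :
    ENNReal.ofReal (Real.exp a) ^ n = ENNReal.ofReal (Real.exp (n * a)) := by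
  rw [← ENNReal.ofReal_pow (Real.exp_pos _).le, ← Real.exp_nat_mul]

theorem natCast_rpow_mul_ofReal_mul_rpow {p c G : ℝ} (hc : 0 < c) {n : ℕ}
    (hn : n ≠ 0) : (n : ℝ≥0∞) ^ (1 / p) * ENNReal.ofReal ((n * c) ^ (-1 / p) * G) =
      ENNReal.ofReal (c ^ (-1 / p) * G) := by
  have hn' : (0 : ℝ) < n := by positivity
  rw [← ENNReal.ofReal_natCast, ENNReal.ofReal_rpow_of_pos hn',
    ← ENNReal.ofReal_mul (by positivity), Real.mul_rpow hn'.le hc.le, ← mul_assoc, ← mul_assoc,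
    ← Real.rpow_add hn']
  congr 1
  rw [show 1 / p + -1 / p = 0 by ring, Real.rpow_zero, one_mul]

theorem rpow_mul_lintegral_pow_le {p c : ℝ} (hp : 0 < p) (hc : 0 < c) {ψ : ℝ → ℝ≥0∞}
    (hψ : ∀ s, 0 < s → ψ s ≤ ENNReal.ofReal (Real.exp (-c * s ^ p))) (n : ℕ) :
    (n : ℝ≥0∞) ^ (1 / p) * ∫⁻ s in Set.Ioi (0 : ℝ), ψ s ^ n ≤
      ENNReal.ofReal (c ^ (-1 / p) * Real.Gamma (1 / p + 1)) := by
  rcases eq_or_ne n 0 with rfl | hn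
  · simp [hp]
  rw [← natCast_rpow_mul_ofReal_mul_rpow hc hn,
    ← lintegral_exp_neg_mul_rpow hp (by positivity)]
  refine mul_le_mul_right (setLIntegral_mono (by fun_prop) fun s hs => ?_) _
  grw [hψ s hs, ofReal_exp_pow]
  rw [show n * (-c * s ^ p) = -(n * c) * s ^ p by ring]

theorem limsup_rpow_mul_lintegral_pow_le {p c c' r : ℝ} (hp : 0 < p) (hc : 0 < c)
    (hc' : 0 < c') (hr : 0 < r) {ψ : ℝ → ℝ≥0∞}
    (hψ : ∀ s, 0 < s → ψ s ≤ ENNReal.ofReal (Real.exp (-c' * s ^ p)))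
    (hψr : ∀ s, 0 < s → s < r → ψ s ≤ ENNReal.ofReal (Real.exp (-c * s ^ p))) :
    limsup (fun n : ℕ => (n : ℝ≥0∞) ^ (1 / p) * ∫⁻ s in Set.Ioi (0 : ℝ), ψ s ^ n) atTop ≤
      ENNReal.ofReal (c ^ (-1 / p) * Real.Gamma (1 / p + 1)) := by
  set κ := c' * r ^ p with hκ
  have hκ0 : 0 < κ := by positivity
  set C := c' ^ (-1 / p) * Real.Gamma (1 / p + 1) with hC
  have hlim : Tendsto (fun n : ℕ => ENNReal.ofReal (c ^ (-1 / p) * Real.Gamma (1 / p + 1)) +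
      ENNReal.ofReal ((n : ℝ) ^ (1 / p) * Real.exp (-κ * n) * (Real.exp κ * C))) atTop
      (nhds (ENNReal.ofReal (c ^ (-1 / p) * Real.Gamma (1 / p + 1)))) := by
    have h1 : Tendsto (fun n : ℕ => (n : ℝ) ^ (1 / p) * Real.exp (-κ * n) * (Real.exp κ * C))
        atTop (nhds 0) := by
      simpa using ((tendsto_rpow_mul_exp_neg_mul_atTop_nhds_zero (1 / p) κ hκ0).comp
        tendsto_natCast_atTop_atTop).mul_const (Real.exp κ * C)
    have h2 := ENNReal.tendsto_ofReal h1
    rw [ENNReal.ofReal_zero] at h2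
    simpa using tendsto_const_nhds.add h2
  rw [← hlim.limsup_eq]
  refine limsup_le_limsup ?_
  filter_upwards [eventually_ge_atTop 1] with n hn
  have hn0 : n ≠ 0 := by omega
  have hn' : (0 : ℝ) < n := by positivity
  have key : ∫⁻ s in Set.Ioi (0 : ℝ), ψ s ^ n ≤
      ENNReal.ofReal ((n * c) ^ (-1 / p) * Real.Gamma (1 / p + 1)) +
        ENNReal.ofReal (Real.exp (-κ * n) * Real.exp κ) * ENNReal.ofReal C := by
    rw [hC, ← lintegral_exp_neg_mul_rpow hp (show 0 < n * c by positivity),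
      ← lintegral_exp_neg_mul_rpow hp hc', ← lintegral_const_mul _ (by fun_prop),
      ← lintegral_add_left (by fun_prop)]
    refine setLIntegral_mono (by fun_prop) fun s hs => ?_
    rcases lt_or_ge s r with hsr | hsr
    · refine le_trans ?_ le_self_add
      grw [hψr s hs hsr, ofReal_exp_pow]
      rw [show n * (-c * s ^ p) = -(n * c) * s ^ p by ring]
    · refine le_trans ?_ le_add_self
      grw [hψ s hs, ofReal_exp_pow]
      rw [← Real.exp_add, ← ENNReal.ofReal_mul (Real.exp_pos _).le, ← Real.exp_add]
      refine ENNReal.ofReal_le_ofReal (Real.exp_le_exp.2 ?_)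
      have h1 : κ ≤ c' * s ^ p := by rw [hκ]; gcongr
      have h2 : (1 : ℝ) ≤ n := by exact_mod_cast hn
      nlinarith
  grw [key, mul_add, natCast_rpow_mul_ofReal_mul_rpow hc hn0]
  gcongr
  rw [← ENNReal.ofReal_natCast, ENNReal.ofReal_rpow_of_pos hn',
    ← ENNReal.ofReal_mul (by positivity), ← ENNReal.ofReal_mul (by positivity)]
  refine le_of_eq (congrArg _ ?_)
  ring

theorem quantErr_le_lintegral_iInf {E : Type*} [PseudoMetricSpace E] [MeasurableSpace E]
    [OpensMeasurableSpace E] (μ : Measure E) {k : ℝ} (hk : 0 < k) {n : ℕ} (hn : n ≠ 0)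
    (y : Fin n → E) :
    quantErr μ (fun x y : E => ENNReal.ofReal (dist x y ^ k)) n ≤
      ∫⁻ x, ⨅ i, ENNReal.ofReal (dist x (y i) ^ k) ∂μ := by
  have hn1 : n - 1 < n := by omega
  set e : ℕ → E := fun j => y ⟨min j (n - 1), by omega⟩ with he
  set f := SimpleFunc.nearestPt e (n - 1) with hf
  refine (iInf₂_le (f : E → E) (And.intro f.measurable
    ⟨Finset.univ.image y, ?card, fun x => ?mem⟩)).trans ?le
  case card => exact (Finset.card_image_le (s := Finset.univ) (f := y)).trans_eq (by simp)
  case mem => exact Finset.mem_image.2 ⟨_, Finset.mem_univ _, rfl⟩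
  case le =>
    refine lintegral_mono fun x => le_iInf fun i => ENNReal.ofReal_le_ofReal ?_
    refine Real.rpow_le_rpow dist_nonneg ?_ hk.le
    have h := SimpleFunc.edist_nearestPt_le e x (k := i) (N := n - 1) (by omega)
    have hei : e i = y i := by
      simp only [he]
      congr 1
      exact Fin.ext (by simp; omega)
    rw [hei, edist_dist, edist_dist, ENNReal.ofReal_le_ofReal_iff dist_nonneg] at h
    rwa [dist_comm x, dist_comm x]

theorem ennreal_rpow_le_mul_add_one_sub {α : ℝ} (hα0 : 0 < α) (hα1 : α < 1) {g : ℝ≥0∞}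
    (hg : g ≠ ∞) :
    g ^ α ≤ ENNReal.ofReal α * g + ENNReal.ofReal (1 - α) ∧
      (g ^ α = ENNReal.ofReal α * g + ENNReal.ofReal (1 - α) → g = 1) := by
  lift g to NNReal using hg
  have hs : -1 ≤ (g : ℝ) - 1 := by linarith [g.2]
  have hrhs : ENNReal.ofReal α * g + ENNReal.ofReal (1 - α) =
      ENNReal.ofReal (1 + α * ((g : ℝ) - 1)) := by
    rw [← ENNReal.ofReal_coe_nnreal, ← ENNReal.ofReal_mul hα0.le,
      ← ENNReal.ofReal_add (by positivity) (by linarith)]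
    congr 1
    ring
  have hlhs : (g : ℝ≥0∞) ^ α = ENNReal.ofReal ((1 + ((g : ℝ) - 1)) ^ α) := by
    rw [← ENNReal.ofReal_coe_nnreal, ENNReal.ofReal_rpow_of_nonneg g.coe_nonneg hα0.le]
    congr 2
    ring
  have hnn : 0 ≤ 1 + α * ((g : ℝ) - 1) := by nlinarith [g.2]
  rw [hrhs, hlhs]
  refine ⟨ENNReal.ofReal_le_ofReal (rpow_one_add_le_one_add_mul_self hs hα0.le hα1.le),
    fun h => ?_⟩
  by_contra hne
  have hne' : (g : ℝ) - 1 ≠ 0 := by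
    intro h0
    apply hne
    have : (g : ℝ) = 1 := by linarith
    exact_mod_cast this
  have hlt := rpow_one_add_lt_one_add_mul_self hs hne' hα0 hα1
  rw [ENNReal.ofReal_eq_ofReal_iff (Real.rpow_nonneg (by linarith) _) hnn] at h
  linarith

theorem lintegral_rnDeriv_rpow_le_one {E : Type*} [MeasurableSpace E] (μ ν : Measure E)
    [IsProbabilityMeasure μ] [IsProbabilityMeasure ν] (hac : ν ≪ μ) {α : ℝ} (hα0 : 0 < α)
    (hα1 : α < 1) :
    (∫⁻ x, (ν.rnDeriv μ x) ^ α ∂μ) ≤ 1 ∧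
      ((∫⁻ x, (ν.rnDeriv μ x) ^ α ∂μ) = 1 → ν.rnDeriv μ =ᵐ[ν] 1) := by
  have hmeas := Measure.measurable_rnDeriv ν μ
  have htop : ∀ᵐ x ∂μ, ν.rnDeriv μ x ≠ ∞ := Measure.rnDeriv_ne_top ν μ
  have hle : ∀ᵐ x ∂μ, ν.rnDeriv μ x ^ α ≤
      ENNReal.ofReal α * ν.rnDeriv μ x + ENNReal.ofReal (1 - α) := by
    filter_upwards [htop] with x hx using (ennreal_rpow_le_mul_add_one_sub hα0 hα1 hx).1
  have hintegral : ∫⁻ x, (ENNReal.ofReal α * ν.rnDeriv μ x + ENNReal.ofReal (1 - α)) ∂μ = 1 := by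
    rw [lintegral_add_right _ measurable_const, lintegral_const_mul _ hmeas,
      Measure.lintegral_rnDeriv hac, lintegral_const]
    simp only [measure_univ, mul_one]
    rw [← ENNReal.ofReal_add hα0.le (by linarith)]
    simp
  refine ⟨hintegral ▸ lintegral_mono_ae hle, fun h => ?_⟩
  have hae : (fun x => ν.rnDeriv μ x ^ α) =ᵐ[μ]
      fun x => ENNReal.ofReal α * ν.rnDeriv μ x + ENNReal.ofReal (1 - α) :=
    ae_eq_of_ae_le_of_lintegral_le hle (by rw [h]; exact ENNReal.one_ne_top) (by fun_prop)
      (by rw [hintegral, h])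
  refine hac.ae_eq ?_
  filter_upwards [hae, htop] with x hx hxt using (ennreal_rpow_le_mul_add_one_sub hα0 hα1 hxt).2 hx

theorem lintegral_pi_iInf_dist_rpow {E : Type*} [PseudoMetricSpace E] [MeasurableSpace E]
    [OpensMeasurableSpace E] (Q : Measure E) [IsProbabilityMeasure Q] {k : ℝ} (hk : 0 < k)
    {n : ℕ} (hn : n ≠ 0) (x : E) :
    ∫⁻ y : Fin n → E, ⨅ i, ENNReal.ofReal (dist x (y i) ^ k) ∂Measure.pi (fun _ => Q) =
      ∫⁻ s in Set.Ioi (0 : ℝ), Q (Metric.ball x (s ^ (1 / k)))ᶜ ^ n := by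
  have : Nonempty (Fin n) := ⟨⟨0, by omega⟩⟩
  set f : (Fin n → E) → ℝ≥0∞ := fun y => ⨅ i, ENNReal.ofReal (dist x (y i) ^ k) with hf
  have hftop : ∀ y, f y ≠ ∞ := fun y =>
    ne_top_of_le_ne_top ENNReal.ofReal_ne_top (iInf_le _ (Classical.arbitrary (Fin n)))
  have hfmeas : Measurable f := by
    refine Measurable.iInf fun i => ?_
    have h : Measurable fun z : E => dist x z := by fun_prop
    exact ((h.comp (measurable_pi_apply i)).pow_const k).ennreal_ofReal
  have hlayer := lintegral_eq_lintegral_meas_le (f := fun y => (f y).toReal)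
    (Measure.pi fun _ : Fin n => Q) (Eventually.of_forall fun _ => ENNReal.toReal_nonneg)
    hfmeas.ennreal_toReal.aemeasurable
  simp only [ENNReal.ofReal_toReal (hftop _)] at hlayer
  rw [hlayer]
  refine setLIntegral_congr_fun measurableSet_Ioi fun s hs => ?_
  have hset : {y : Fin n → E | s ≤ (f y).toReal} =
      Set.univ.pi fun _ => (Metric.ball x (s ^ (1 / k)))ᶜ := by
    ext y
    have hiff : ∀ z : E, ENNReal.ofReal s ≤ ENNReal.ofReal (dist x z ^ k) ↔
        s ^ (1 / k) ≤ dist x z := fun z => by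
      rw [ENNReal.ofReal_le_ofReal_iff (by positivity), one_div,
        Real.rpow_inv_le_iff_of_pos (le_of_lt hs) dist_nonneg hk]
    rw [Set.mem_ofPred_eq, ← ENNReal.ofReal_le_iff_le_toReal (hftop y)]
    simp only [hf, le_iInf_iff, hiff, Set.mem_pi, Set.mem_univ, forall_true_left,
      Set.mem_compl_iff, Metric.mem_ball', not_lt]
  simp only [hset, Measure.pi_pi, Finset.prod_const, Finset.card_univ, Fintype.card_fin]

/-- Random coding bound: a codebook of `n` independent points with law `Q` is used. -/
theorem limsup_quantErr_le_of_measure_compl_ball_le {E : Type*} [PseudoMetricSpace E]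
    [MeasurableSpace E] [BorelSpace E] [SecondCountableTopology E] (μ Q : Measure E)
    [IsFiniteMeasure μ] [IsProbabilityMeasure Q] {k m c' : ℝ} (hk : 0 < k) (hm : 0 < m)
    (hc' : 0 < c') {c : E → ℝ}
    (hQ : ∀ (x : E) (t : ℝ), 0 < t →
      Q (Metric.ball x t)ᶜ ≤ ENNReal.ofReal (Real.exp (-c' * t ^ m)))
    (hQc : ∀ᵐ x ∂μ, 0 < c x ∧ ∃ r : ℝ, 0 < r ∧ ∀ t, 0 < t → t < r →
      Q (Metric.ball x t)ᶜ ≤ ENNReal.ofReal (Real.exp (-c x * t ^ m))) :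
    limsup (fun n : ℕ => (n : ℝ≥0∞) ^ (k / m) *
        quantErr μ (fun x y : E => ENNReal.ofReal (dist x y ^ k)) n) atTop ≤
      ∫⁻ x, ENNReal.ofReal (c x ^ (-(k / m)) * Real.Gamma (1 + k / m)) ∂μ := by
  have hp : 0 < m / k := by positivity
  have hexp : 1 / (m / k) = k / m := one_div_div m k
  have hexp' : -1 / (m / k) = -(k / m) := by rw [neg_div, hexp]
  have hpow : ∀ s : ℝ, 0 < s → (s ^ (1 / k)) ^ m = s ^ (m / k) := fun s hs => by
    rw [← Real.rpow_mul hs.le, one_div_mul_eq_div]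
  set J : ℕ → E → ℝ≥0∞ := fun n x => (n : ℝ≥0∞) ^ (k / m) *
    ∫⁻ y : Fin n → E, ⨅ i, ENNReal.ofReal (dist x (y i) ^ k) ∂Measure.pi (fun _ => Q) with hJ
  have hJmeas₂ : ∀ n : ℕ, Measurable fun q : E × (Fin n → E) =>
      ⨅ i, ENNReal.ofReal (dist q.1 (q.2 i) ^ k) := fun n => by
    refine Measurable.iInf fun i => ?_
    have h : Measurable fun q : E × (Fin n → E) => dist q.1 (q.2 i) :=
      measurable_fst.dist ((measurable_pi_apply i).comp measurable_snd)
    exact (h.pow_const k).ennreal_ofReal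
  have hJmeas : ∀ n, Measurable (J n) := fun n => (hJmeas₂ n).lintegral_prod_right'.const_mul _
  have hJeq : ∀ n x, J n x = (n : ℝ≥0∞) ^ (1 / (m / k)) *
      ∫⁻ s in Set.Ioi (0 : ℝ), Q (Metric.ball x (s ^ (1 / k)))ᶜ ^ n := fun n x => by
    rcases eq_or_ne n 0 with rfl | hn
    · have h : 0 < k / m := by positivity
      simp [hJ, hexp, ENNReal.zero_rpow_of_pos h]
    · simp only [hJ, hexp, lintegral_pi_iInf_dist_rpow Q hk hn x]
  have hψ : ∀ (x : E) (s : ℝ), 0 < s → Q (Metric.ball x (s ^ (1 / k)))ᶜ ≤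
      ENNReal.ofReal (Real.exp (-c' * s ^ (m / k))) := fun x s hs => by
    rw [← hpow s hs]
    exact hQ x _ (by positivity)
  have hbound : ∀ n x, J n x ≤
      ENNReal.ofReal (c' ^ (-1 / (m / k)) * Real.Gamma (1 / (m / k) + 1)) := fun n x => by
    rw [hJeq]
    exact rpow_mul_lintegral_pow_le hp hc' (hψ x) n
  have hV : ∀ n : ℕ, (n : ℝ≥0∞) ^ (k / m) *
      quantErr μ (fun x y : E => ENNReal.ofReal (dist x y ^ k)) n ≤ ∫⁻ x, J n x ∂μ := fun n => by
    rcases eq_or_ne n 0 with rfl | hn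
    · have h : 0 < k / m := by positivity
      simp [ENNReal.zero_rpow_of_pos h]
    · simp only [hJ]
      rw [lintegral_const_mul _ (hJmeas₂ n).lintegral_prod_right',
        lintegral_lintegral_swap (hJmeas₂ n).aemeasurable]
      gcongr
      calc quantErr μ (fun x y : E => ENNReal.ofReal (dist x y ^ k)) n
          = ∫⁻ _ : Fin n → E, quantErr μ (fun x y : E => ENNReal.ofReal (dist x y ^ k)) n
              ∂Measure.pi (fun _ => Q) := by simp
        _ ≤ _ := lintegral_mono fun y => quantErr_le_lintegral_iInf μ hk hn y
  refine (limsup_le_limsup (Eventually.of_forall hV)).trans ?_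
  refine (limsup_lintegral_le (fun _ => ENNReal.ofReal
    (c' ^ (-1 / (m / k)) * Real.Gamma (1 / (m / k) + 1))) hJmeas
    (fun n => Eventually.of_forall (hbound n)) ?_).trans ?_
  · rw [lintegral_const]
    exact ENNReal.mul_ne_top ENNReal.ofReal_ne_top (measure_ne_top μ _)
  refine lintegral_mono_ae ?_
  filter_upwards [hQc] with x ⟨hcx, r, hr, hx⟩
  simp only [hJeq]
  refine (limsup_rpow_mul_lintegral_pow_le hp hcx hc' (r := r ^ k) (by positivity) (hψ x)
    fun s hs hsr => ?_).trans ?_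
  · rw [← hpow s hs]
    refine hx _ (by positivity) ?_
    rw [one_div]
    exact (Real.rpow_inv_lt_iff_of_pos hs.le hr.le hk).2 hsr
  · rw [hexp, hexp', add_comm]

theorem measure_compl_le_ofReal_exp_neg {E : Type*} [MeasurableSpace E] (Q : Measure E)
    [IsProbabilityMeasure Q] {B : Set E} (hB : MeasurableSet B) {a : ℝ}
    (ha : ENNReal.ofReal a ≤ Q B) : Q Bᶜ ≤ ENNReal.ofReal (Real.exp (-a)) := by
  rw [prob_compl_eq_one_sub hB]
  rcases le_or_gt a 0 with h | h
  · refine tsub_le_self.trans ?_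
    rw [ENNReal.one_le_ofReal]
    exact Real.one_le_exp (by linarith)
  · grw [← ha]
    rw [← ENNReal.ofReal_one, ← ENNReal.ofReal_sub _ h.le]
    exact ENNReal.ofReal_le_ofReal (by linarith [Real.add_one_le_exp (-a)])

/-- A measurable density `φ` can be replaced, at the cost of a factor `1 + ε`, by a probability
measure which locally dominates `φ x • ν` near every point `x`. -/
theorem exists_isProbabilityMeasure_locally_dominating {E : Type*} [PseudoMetricSpace E]
    [MeasurableSpace E] [BorelSpace E] (ν : Measure E) [IsProbabilityMeasure ν]
    {φ : E → NNReal} (hφ : Measurable φ) (hφ1 : ∫⁻ x, φ x ∂ν ≤ 1) {ε : ℝ≥0∞} (hε : ε ≠ 0)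
    (hε' : ε ≠ ∞) :
    ∃ Q : Measure E, IsProbabilityMeasure Q ∧
      (∀ x, ∃ r : ℝ, 0 < r ∧ ∀ t ≤ r, φ x * ν (Metric.ball x t) ≤
        (1 + ε) * Q (Metric.ball x t)) ∧
      ∀ η : NNReal, (∀ᵐ y ∂ν, η ≤ φ y) → ∀ B, MeasurableSet B → η * ν B ≤ (1 + ε) * Q B := by
  obtain ⟨h, hφh, hlsc, hintegral⟩ := exists_lt_lowerSemicontinuous_lintegral_ge ν φ hφ hε
  have hhmeas : Measurable h := hlsc.measurable
  set T := ∫⁻ x, h x ∂ν with hT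
  have hT1 : T ≤ 1 + ε := hintegral.trans (by gcongr)
  have hTtop : T ≠ ∞ := ne_top_of_le_ne_top (by finiteness) hT1
  have hT0 : T ≠ 0 := by
    intro h0
    rw [hT, lintegral_eq_zero_iff hhmeas] at h0
    obtain ⟨x, hx⟩ := h0.exists
    exact (bot_le.trans_lt (hφh x)).ne' hx
  have hQB : ∀ (B : Set E) (η : NNReal), MeasurableSet B → (∀ᵐ y ∂ν, y ∈ B → (η : ℝ≥0∞) ≤ h y) →
      η * ν B ≤ (1 + ε) * (T⁻¹ • ν.withDensity h) B := fun B η hB hη => by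
    rw [Measure.smul_apply, withDensity_apply _ hB, smul_eq_mul]
    calc (η : ℝ≥0∞) * ν B = ∫⁻ _ in B, η ∂ν := (setLIntegral_const B _).symm
      _ ≤ ∫⁻ y in B, h y ∂ν := setLIntegral_mono_ae hhmeas.aemeasurable hη
      _ = T * (T⁻¹ * ∫⁻ y in B, h y ∂ν) := by
        rw [← mul_assoc, ENNReal.mul_inv_cancel hT0 hTtop, one_mul]
      _ ≤ _ := by gcongr
  refine ⟨T⁻¹ • ν.withDensity h, ⟨?_⟩, fun x => ?_, fun η hη B hB => ?_⟩
  · rw [Measure.smul_apply, withDensity_apply _ MeasurableSet.univ, Measure.restrict_univ,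
      smul_eq_mul, ENNReal.inv_mul_cancel hT0 hTtop]
  · obtain ⟨r, hr, hrx⟩ := Metric.eventually_nhds_iff_ball.1 (hlsc x _ (hφh x))
    refine ⟨r, hr, fun t ht => hQB _ _ measurableSet_ball ?_⟩
    exact Eventually.of_forall fun y hy => (hrx y (Metric.ball_subset_ball ht hy)).le
  · refine hQB B η hB ?_
    filter_upwards [hη] with y hy _
    exact (ENNReal.coe_le_coe.2 hy).trans (hφh y).le

theorem lintegral_inv_rnDeriv_add_le_one {E : Type*} [MeasurableSpace E] (μ ν : Measure E)
    [IsProbabilityMeasure μ] [IsFiniteMeasure ν] (hac : ν ≪ μ) (ε : ℝ≥0∞) :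
    ∫⁻ x, (ν.rnDeriv μ x + ε)⁻¹ ∂ν ≤ 1 := by
  have hmeas := Measure.measurable_rnDeriv ν μ
  rw [← lintegral_rnDeriv_mul hac (by fun_prop)]
  calc ∫⁻ x, ν.rnDeriv μ x * (ν.rnDeriv μ x + ε)⁻¹ ∂μ ≤ ∫⁻ _, 1 ∂μ :=
        lintegral_mono fun x => (mul_le_mul' le_self_add le_rfl).trans (ENNReal.mul_inv_le_one _)
    _ = 1 := by simp

/-- A regularity bound for small radii extends to all radii, in terms of complements of balls, when
the space has bounded diameter. -/
theorem exists_measure_compl_ball_le {E : Type*} [PseudoMetricSpace E] [MeasurableSpace E]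
    [OpensMeasurableSpace E] (Q : Measure E) [IsProbabilityMeasure Q] {m a δ D : ℝ} (hm : 0 < m)
    (ha : 0 < a) (hδ : 0 < δ) (hD : ∀ x y : E, dist x y ≤ D)
    (hQ : ∀ (x : E) (t : ℝ), 0 < t → t < δ → ENNReal.ofReal (a * t ^ m) ≤ Q (Metric.ball x t)) :
    ∃ c' : ℝ, 0 < c' ∧ ∀ (x : E) (t : ℝ), 0 < t →
      Q (Metric.ball x t)ᶜ ≤ ENNReal.ofReal (Real.exp (-c' * t ^ m)) := by
  set R := max D δ with hR
  have hδR : δ ≤ R := le_max_right _ _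
  have hR0 : 0 < R := hδ.trans_le hδR
  refine ⟨a * (δ / 2 / R) ^ m, by positivity, fun x t ht => ?_⟩
  rw [neg_mul, mul_assoc, ← Real.mul_rpow (by positivity) ht.le]
  rcases lt_or_ge R t with htR | htR
  · have huniv : Metric.ball x t = Set.univ := Set.eq_univ_of_forall fun y =>
      ((hD y x).trans (le_max_left _ _)).trans_lt htR
    simp [huniv]
  · refine measure_compl_le_ofReal_exp_neg Q measurableSet_ball ?_
    rcases lt_or_ge t δ with htδ | htδ
    · refine le_trans (ENNReal.ofReal_le_ofReal ?_) (hQ x t ht htδ)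
      gcongr
      refine mul_le_of_le_one_left ht.le ?_
      rw [div_le_one hR0]
      linarith
    · refine le_trans (ENNReal.ofReal_le_ofReal ?_)
        ((hQ x (δ / 2) (by positivity) (by linarith)).trans
          (measure_mono (Metric.ball_subset_ball (by linarith))))
      gcongr
      rw [div_mul_eq_mul_div, div_le_iff₀ hR0]
      gcongr

theorem limsup_quantErr_le_add {E : Type*} [PseudoMetricSpace E]
    [MeasurableSpace E] [BorelSpace E] [SecondCountableTopology E] (μ ν : Measure E)
    [IsProbabilityMeasure μ] [IsProbabilityMeasure ν] (hac : ν ≪ μ)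
    (hbdd : essSup (ν.rnDeriv μ) μ < ∞) {k m b δ D ε : ℝ} (hk : 0 < k) (hkm : k < m)
    (hb : 0 < b) (hδ : 0 < δ) (hD : ∀ x y : E, dist x y ≤ D) (hε : 0 < ε)
    (hν : ∀ (x : E) (t : ℝ), 0 < t → t < δ → ENNReal.ofReal (b * t ^ m) ≤ ν (Metric.ball x t)) :
    limsup (fun n : ℕ => (n : ℝ≥0∞) ^ (k / m) *
        quantErr μ (fun x y : E => ENNReal.ofReal (dist x y ^ k)) n) atTop ≤
      ENNReal.ofReal (Real.Gamma (1 + k / m) * b ^ (-(k / m))) *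
        (ENNReal.ofReal (1 + ε) ^ (k / m) *
          (∫⁻ x, (ν.rnDeriv μ x) ^ (k / m) ∂μ + ENNReal.ofReal ε ^ (k / m))) := by
  have hm : 0 < m := hk.trans hkm
  have hα : 0 < k / m := by positivity
  have hα1 : k / m ≤ 1 := by rw [div_le_one hm]; exact hkm.le
  set g := ν.rnDeriv μ with hg
  have hgmeas : Measurable g := Measure.measurable_rnDeriv ν μ
  have hε0 : ENNReal.ofReal ε ≠ 0 := by simpa using hε
  set φ : E → NNReal := fun x => (g x + ENNReal.ofReal ε)⁻¹.toNNReal with hφ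
  have hφcoe : ∀ x, (φ x : ℝ≥0∞) = (g x + ENNReal.ofReal ε)⁻¹ := fun x =>
    ENNReal.coe_toNNReal (ENNReal.inv_ne_top.2 (by simp [hε]))
  obtain ⟨Q, hQprob, hQloc, hQglob⟩ := exists_isProbabilityMeasure_locally_dominating ν
    (φ := φ) (by fun_prop) (by
      simp only [hφcoe]
      exact lintegral_inv_rnDeriv_add_le_one μ ν hac _) hε0 ENNReal.ofReal_ne_top
  have hε1 : 1 + ENNReal.ofReal ε = ENNReal.ofReal (1 + ε) := by
    rw [ENNReal.ofReal_add zero_le_one hε.le, ENNReal.ofReal_one]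
  have hQlower : ∀ (η : NNReal) (x : E) (t : ℝ), 0 < t → t < δ →
      η * ν (Metric.ball x t) ≤ (1 + ENNReal.ofReal ε) * Q (Metric.ball x t) →
      ENNReal.ofReal (b * (η / (1 + ε)) * t ^ m) ≤ Q (Metric.ball x t) := by
    intro η x t ht htδ h
    rw [← ENNReal.mul_le_mul_iff_right (a := ENNReal.ofReal (1 + ε))
      (by simp; linarith) ENNReal.ofReal_ne_top, ← hε1]
    refine le_trans ?_ h
    grw [← hν x t ht htδ]
    rw [hε1, ← ENNReal.ofReal_coe_nnreal, ← ENNReal.ofReal_mul (by positivity),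
      ← ENNReal.ofReal_mul (by positivity)]
    refine le_of_eq (congrArg _ ?_)
    field_simp
  obtain ⟨c', hc', hQc'⟩ : ∃ c' : ℝ, 0 < c' ∧ ∀ (x : E) (t : ℝ), 0 < t →
      Q (Metric.ball x t)ᶜ ≤ ENNReal.ofReal (Real.exp (-c' * t ^ m)) := by
    set M := essSup g μ
    set η : NNReal := (M + ENNReal.ofReal ε)⁻¹.toNNReal with hη
    have hηcoe : (η : ℝ≥0∞) = (M + ENNReal.ofReal ε)⁻¹ :=
      ENNReal.coe_toNNReal (ENNReal.inv_ne_top.2 (by simp [hε]))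
    have hη0 : 0 < η := by
      rw [← ENNReal.coe_pos, hηcoe]
      exact ENNReal.inv_pos.2 (by finiteness)
    have hηφ : ∀ᵐ y ∂ν, η ≤ φ y := by
      filter_upwards [hac.ae_le (ENNReal.ae_le_essSup g)] with y hy
      rw [← ENNReal.coe_le_coe, hηcoe, hφcoe]
      gcongr
    refine exists_measure_compl_ball_le Q (a := b * (η / (1 + ε))) hm
      (by have : (0 : ℝ) < η := hη0; positivity) hδ hD fun x t ht htδ => ?_
    exact hQlower η x t ht htδ (hQglob η hηφ _ measurableSet_ball)
  refine (limsup_quantErr_le_of_measure_compl_ball_le μ Q hk hm hc'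
    (c := fun x => b * (φ x / (1 + ε))) hQc' ?_).trans ?_
  · filter_upwards [Measure.rnDeriv_ne_top ν μ] with x hx
    have hφ0 : 0 < φ x := by
      rw [← ENNReal.coe_pos, hφcoe]
      exact ENNReal.inv_pos.2 (by finiteness)
    obtain ⟨r, hr, hrx⟩ := hQloc x
    refine ⟨by have : (0 : ℝ) < φ x := hφ0; positivity, min r δ, lt_min hr hδ,
      fun t ht htr => ?_⟩
    rw [neg_mul]
    refine measure_compl_le_ofReal_exp_neg Q measurableSet_ball ?_
    exact hQlower _ x t ht (htr.trans_le (min_le_right _ _))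
      (hrx t (htr.le.trans (min_le_left _ _)))
  · calc ∫⁻ x, ENNReal.ofReal ((b * (φ x / (1 + ε))) ^ (-(k / m)) * Real.Gamma (1 + k / m)) ∂μ
        ≤ ∫⁻ x, ENNReal.ofReal (Real.Gamma (1 + k / m) * b ^ (-(k / m))) *
          (ENNReal.ofReal (1 + ε) ^ (k / m) *
            (g x ^ (k / m) + ENNReal.ofReal ε ^ (k / m))) ∂μ := by
          refine lintegral_mono_ae ?_
          filter_upwards [Measure.rnDeriv_ne_top ν μ] with x hx
          grw [← ENNReal.rpow_add_le_add_rpow _ _ hα.le hα1]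
          have hsum : g x + ENNReal.ofReal ε = ENNReal.ofReal ((g x).toReal + ε) := by
            rw [ENNReal.ofReal_add ENNReal.toReal_nonneg hε.le, ENNReal.ofReal_toReal hx]
          have hpos : 0 < (g x).toReal + ε := add_pos_of_nonneg_of_pos ENNReal.toReal_nonneg hε
          have hφreal : (φ x : ℝ) = ((g x).toReal + ε)⁻¹ := by
            rw [← ENNReal.toReal_ofReal hpos.le, ← hsum, ← ENNReal.toReal_inv]
            rfl
          have hG : 0 < Real.Gamma (1 + k / m) := Real.Gamma_pos_of_pos (by positivity)
          rw [hsum, ENNReal.ofReal_rpow_of_pos (by positivity), ENNReal.ofReal_rpow_of_pos hpos,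
            ← ENNReal.ofReal_mul (by positivity), ← ENNReal.ofReal_mul (by positivity), hφreal]
          refine le_of_eq (congrArg _ ?_)
          rw [Real.mul_rpow hb.le (by positivity), Real.div_rpow (by positivity) (by positivity),
            Real.inv_rpow hpos.le, Real.rpow_neg hpos.le, Real.rpow_neg (by positivity : 0 ≤ 1 + ε)]
          field_simp
      _ = _ := by
          rw [lintegral_const_mul _ (by fun_prop), lintegral_const_mul _ (by fun_prop),
            lintegral_add_left (by fun_prop)]
          simp

theorem limsup_quantErr_le {E : Type*} [PseudoMetricSpace E]
    [MeasurableSpace E] [BorelSpace E] [SecondCountableTopology E] (μ ν : Measure E)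
    [IsProbabilityMeasure μ] [IsProbabilityMeasure ν] (hac : ν ≪ μ)
    (hbdd : essSup (ν.rnDeriv μ) μ < ∞) {k m b δ D : ℝ} (hk : 0 < k) (hkm : k < m)
    (hb : 0 < b) (hδ : 0 < δ) (hD : ∀ x y : E, dist x y ≤ D)
    (hν : ∀ (x : E) (t : ℝ), 0 < t → t < δ → ENNReal.ofReal (b * t ^ m) ≤ ν (Metric.ball x t)) :
    limsup (fun n : ℕ => (n : ℝ≥0∞) ^ (k / m) *
        quantErr μ (fun x y : E => ENNReal.ofReal (dist x y ^ k)) n) atTop ≤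
      (∫⁻ x, (ν.rnDeriv μ x) ^ (k / m) ∂μ) *
        ENNReal.ofReal (Real.Gamma (1 + k / m) * b ^ (-(k / m))) := by
  have hα : 0 < k / m := div_pos hk (hk.trans hkm)
  have hcont : Continuous fun ε : ℝ => ENNReal.ofReal ε ^ (k / m) :=
    ENNReal.continuous_rpow_const.comp ENNReal.continuous_ofReal
  set Ω := ∫⁻ x, (ν.rnDeriv μ x) ^ (k / m) ∂μ with hΩ
  have hlim : Tendsto (fun ε : ℝ => ENNReal.ofReal (Real.Gamma (1 + k / m) * b ^ (-(k / m))) *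
        (ENNReal.ofReal (1 + ε) ^ (k / m) * (Ω + ENNReal.ofReal ε ^ (k / m))))
      (nhdsWithin 0 (Set.Ioi 0))
      (nhds (ENNReal.ofReal (Real.Gamma (1 + k / m) * b ^ (-(k / m))) * (1 * (Ω + 0)))) := by
    have h0 : Tendsto (fun ε : ℝ => ENNReal.ofReal ε ^ (k / m)) (nhdsWithin 0 (Set.Ioi 0))
        (nhds 0) := by
      have := hcont.tendsto 0
      simp only [ENNReal.ofReal_zero, ENNReal.zero_rpow_of_pos hα] at this
      exact this.mono_left nhdsWithin_le_nhds
    have h1 : Tendsto (fun ε : ℝ => ENNReal.ofReal (1 + ε) ^ (k / m))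
        (nhdsWithin 0 (Set.Ioi 0)) (nhds 1) := by
      have := (hcont.comp (continuous_const_add (1 : ℝ))).tendsto 0
      simp only [Function.comp_apply, add_zero, ENNReal.ofReal_one, ENNReal.one_rpow] at this
      exact this.mono_left nhdsWithin_le_nhds
    refine ENNReal.Tendsto.const_mul ?_ (Or.inr ENNReal.ofReal_ne_top)
    exact ENNReal.Tendsto.mul h1 (Or.inl one_ne_zero) (tendsto_const_nhds.add h0)
      (Or.inr ENNReal.one_ne_top)
  rw [one_mul, add_zero, mul_comm _ Ω] at hlim
  refine ge_of_tendsto hlim ?_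
  filter_upwards [self_mem_nhdsWithin] with ε hε
  exact limsup_quantErr_le_add μ ν hac hbdd hk hkm hb hδ hD hε hν

theorem limsup_quantErr_le_of_measurable_metric {E : Type*} [MeasurableSpace E]
    [StandardBorelSpace E] (ω : E → E → ℝ) (hω_meas : Measurable (Function.uncurry ω))
    (hω_self : ∀ x, ω x x = 0) (hω_eq : ∀ x y, ω x y = 0 → x = y)
    (hω_symm : ∀ x y, ω x y = ω y x) (hω_tri : ∀ x y z, ω x z ≤ ω x y + ω y z)
    (μ ν : Measure E) [IsProbabilityMeasure μ] [IsProbabilityMeasure ν] (hac : ν ≪ μ)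
    (hbdd : essSup (ν.rnDeriv μ) μ < ∞) {k m b δ D : ℝ} (hk : 0 < k) (hkm : k < m)
    (hb : 0 < b) (hδ : 0 < δ) (hD : ∀ x y : E, ω x y ≤ D)
    (hν : ∀ (x : E) (t : ℝ), 0 < t → t < δ → ENNReal.ofReal (b * t ^ m) ≤ ν {y | ω x y < t}) :
    limsup (fun n : ℕ => (n : ℝ≥0∞) ^ (k / m) *
        quantErr μ (fun x y : E => ENNReal.ofReal (ω x y ^ k)) n) atTop ≤
      (∫⁻ x, (ν.rnDeriv μ x) ^ (k / m) ∂μ) *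
        ENNReal.ofReal (Real.Gamma (1 + k / m) * b ^ (-(k / m))) := by
  let hmetric : MetricSpace E :=
    { dist := ω
      dist_self := hω_self
      dist_comm := hω_symm
      dist_triangle := hω_tri
      eq_of_dist_eq_zero := fun {x y} => hω_eq x y }
  have hball_eq : ∀ (x : E) (t : ℝ), Metric.ball x t = {y | ω x y < t} := fun x t =>
    Set.ext fun y => Metric.mem_ball'
  have hball : ∀ (x : E) (t : ℝ), MeasurableSet (Metric.ball x t) := fun x t => by
    rw [hball_eq]
    exact measurableSet_lt (hω_meas.comp measurable_prodMk_left) measurable_const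
  have hν' : ∀ (x : E) (t : ℝ), 0 < t → t < δ →
      ENNReal.ofReal (b * t ^ m) ≤ ν (Metric.ball x t) := fun x t => by
    rw [hball_eq]
    exact hν x t
  have hsc : SecondCountableTopology E := by
    refine secondCountableTopology_of_measure_ball_pos ν hball fun x r hr => ?_
    have hs : 0 < min r (δ / 2) := by positivity
    calc 0 < ENNReal.ofReal (b * min r (δ / 2) ^ m) := ENNReal.ofReal_pos.2 (by positivity)
      _ ≤ ν (Metric.ball x (min r (δ / 2))) :=
        hν' x _ hs ((min_le_right _ _).trans_lt (by linarith))
      _ ≤ ν (Metric.ball x r) := measure_mono (Metric.ball_subset_ball (min_le_left _ _))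
  have hborel : BorelSpace E := borelSpace_of_measurableSet_ball hball
  exact limsup_quantErr_le μ ν hac hbdd hk hkm hb hδ hD hν'

/-- Refined upper bound on the asymptotic quantization error for a
random variable with values in a Borel set `S ⊆ ℝ^d` with distortion `ρ = ω^k` for a
metric `ω` on `ℝ^d`, in terms of `Ω_α(X) = E[((dν/dμ_X)(X))^α]` for a probability
measure `ν ≪ μ_X` with bounded density that is `ρ^{1/k}`-superregular of dimension
`m ∈ (k,∞)`. -/
theorem quantization_coefficient_upper_bound_refined
    {d : ℕ} (S : Set (Fin d → ℝ)) (hS : MeasurableSet S)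
    (ω : (Fin d → ℝ) → (Fin d → ℝ) → ℝ)
    (hω_meas : Measurable (Function.uncurry ω))
    (hω_self : ∀ x, ω x x = 0)
    (hω_eq : ∀ x y, ω x y = 0 → x = y)
    (hω_symm : ∀ x y, ω x y = ω y x)
    (hω_tri : ∀ x y z, ω x z ≤ ω x y + ω y z)
    (k m b : ℝ) (δ₀ : ℝ≥0∞) (hk : 0 < k) (hkm : k < m) (hb : 0 < b) (hδ₀ : 0 < δ₀)
    (μX : Measure ↥S) [IsProbabilityMeasure μX]
    (ν : Measure ↥S) [IsProbabilityMeasure ν]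
    (hac : ν ≪ μX)
    (hbdd : essSup (ν.rnDeriv μX) μX < ∞)
    (hsup : ∀ x : ↥S, ∀ t : ℝ, 0 < t → ENNReal.ofReal t < δ₀ →
      ENNReal.ofReal (b * t ^ m) ≤ ν {y : ↥S | ω ↑x ↑y < t})
    (hβ : δ₀ < ∞ → (⨆ x : ↥S, ⨆ y : ↥S, ENNReal.ofReal (ω ↑x ↑y)) < ∞) :
    (Filter.limsup
        (fun n : ℕ => (n : ℝ≥0∞) ^ (k / m) *
          quantErr μX (fun x y : ↥S => ENNReal.ofReal (ω ↑x ↑y ^ k)) n) atTop ≤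
      (∫⁻ x, (ν.rnDeriv μX x) ^ (k / m) ∂μX) *
        ENNReal.ofReal (Real.Gamma (1 + k / m) * b ^ (-(k / m)))) ∧
    (∀ α : ℝ, 0 < α → α < 1 →
      (∫⁻ x, (ν.rnDeriv μX x) ^ α ∂μX) ≤ 1 ∧
      ((∫⁻ x, (ν.rnDeriv μX x) ^ α ∂μX) = 1 → ν.rnDeriv μX =ᵐ[ν] 1)) ∧
    ((Filter.liminf
          (fun n : ℕ => ((qRatio μX (fun x y : ↥S => ENNReal.ofReal (ω ↑x ↑y ^ k)) k n : ℝ)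
            : EReal)) atTop = ((m : ℝ) : EReal) ∧
      Filter.limsup
          (fun n : ℕ => ((qRatio μX (fun x y : ↥S => ENNReal.ofReal (ω ↑x ↑y ^ k)) k n : ℝ)
            : EReal)) atTop = ((m : ℝ) : EReal)) →
      Filter.limsup
          (fun n : ℕ => (n : ℝ≥0∞) ^ (k / m) *
            quantErr μX (fun x y : ↥S => ENNReal.ofReal (ω ↑x ↑y ^ k)) n) atTop ≤
        (∫⁻ x, (ν.rnDeriv μX x) ^ (k / m) ∂μX) *
          ENNReal.ofReal (Real.Gamma (1 + k / m) * b ^ (-(k / m)))) := by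
  have hstd : StandardBorelSpace ↥S := hS.standardBorel
  have hm : 0 < m := hk.trans hkm
  have hδ_top : δ₀ < ∞ := by
    by_contra h
    rw [not_lt, top_le_iff] at h
    obtain ⟨x⟩ := nonempty_of_isProbabilityMeasure ν
    have h1 := (hsup x ((2 / b) ^ (1 / m)) (by positivity) (by simp [h])).trans prob_le_one
    rw [← Real.rpow_mul (by positivity), one_div_mul_cancel hm.ne', Real.rpow_one,
      mul_div_cancel₀ _ hb.ne', ENNReal.ofReal_le_one] at h1
    norm_num at h1
  have hδ : 0 < δ₀.toReal := ENNReal.toReal_pos hδ₀.ne' hδ_top.ne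
  set D := ⨆ x : ↥S, ⨆ y : ↥S, ENNReal.ofReal (ω ↑x ↑y) with hD
  have hDω : ∀ x y : ↥S, ω ↑x ↑y ≤ D.toReal := fun x y =>
    (ENNReal.ofReal_le_iff_le_toReal (hβ hδ_top).ne).1
      (le_iSup₂ (f := fun x y : ↥S => ENNReal.ofReal (ω ↑x ↑y)) x y)
  have hmain := limsup_quantErr_le_of_measurable_metric (fun x y : ↥S => ω ↑x ↑y)
    (hω_meas.comp (measurable_subtype_coe.prodMap measurable_subtype_coe))
    (fun x => hω_self x) (fun x y h => Subtype.ext (hω_eq _ _ h)) (fun x y => hω_symm x y)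
    (fun x y z => hω_tri x y z) μX ν hac hbdd hk hkm hb hδ hDω
    (fun x t ht htδ => hsup x t ht ((ENNReal.ofReal_lt_iff_lt_toReal ht.le hδ_top.ne).2 htδ))
  exact ⟨hmain, fun α hα0 hα1 => lintegral_rnDeriv_rpow_le_one μX ν hac hα0 hα1, fun _ => hmain⟩
end

section
/- Let (X_i)_{i∈ℕ} be a sequence of i.i.d. random variables taking values in a σ-finite measure space (A,𝒜,μ) with μ_{X₁} ≪ μ and Σ_p := ‖dμ_{X₁}/dμ‖_{p/(p-1)}^{(μ)} < ∞ for some p ∈ [1,∞), let (B,ℬ) be a measurable space, and let σ: A×B → [0,∞] be a measurable distortion function. Let k ∈ (0,∞) and suppose μ is σ^{1/k}-subregular of dimension m ∈ (0,∞) with subregularity constants c ∈ (0,∞) and δ₀ ∈ (0,∞]. Fix ℓ ∈ ℕ and let R_{(ℓ)}(D) = inf{ R ∈ [0,∞) : there exists a measurable g: A^ℓ → B^ℓ with |g(A^ℓ)| ≤ ⌊e^{ℓR}⌋ and E[(1/ℓ)·Σ_{i=1}^ℓ σ(X_i, g_i(X₁,…,X_ℓ))] ≤ D }. Then for all D ∈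 (0, D_{(ℓ)}), R_{(ℓ)}(D) ≥ (m/(pk))·log( ℓm/((ℓm+pk)·D) ) − log(d_{(ℓ)}), where d_{(ℓ)} = [Γ(1+m/(pk))·ℓ^{m/(pk)} / Γ(1+ℓm/(pk))^{1/ℓ}]·c^{1/p}·Σ_p and D_{(ℓ)} = (δ₀^k/ℓ)·(ℓm/(ℓm+pk)). -/
open MeasureTheory
open scoped ENNReal Classical

/-- The `q`-norm (with respect to `μ`) of an `ℝ≥0∞`-valued function;
for `q = ∞` it is the `μ`-essential supremum. -/
noncomputable def lpNormENN {X : Type*} [MeasurableSpace X] (μ : Measure X)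
    (f : X → ℝ≥0∞) (q : ℝ≥0∞) : ℝ≥0∞ :=
  if q = ∞ then essSup f μ else (∫⁻ x, (f x) ^ q.toReal ∂μ) ^ (1 / q.toReal)

/-- The conjugate exponent `p/(p-1) ∈ (1,∞]` of `p ∈ [1,∞)` (as an element of `ℝ≥0∞`),
with the convention that the conjugate exponent of `p = 1` is `∞`. -/
noncomputable def conjExp (p : ℝ) : ℝ≥0∞ :=
  if p = 1 then ∞ else ENNReal.ofReal (p / (p - 1))

/-- The operational rate-distortion function `R_{(ℓ)}(D)` of an i.i.d. source with
per-letter distribution `μX`: the infimum (in `ℝ≥0∞`, with `inf ∅ = ∞`) of rates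
`R ≥ 0` for which some measurable source code `g : A^ℓ → B^ℓ` with at most `⌊e^{ℓR}⌋`
codewords achieves expected average distortion at most `D`. -/
noncomputable def opRate {A B : Type*} [MeasurableSpace A] [MeasurableSpace B]
    (μX : Measure A) (σ : A → B → ℝ≥0∞) (ℓ : ℕ) (D : ℝ) : ℝ≥0∞ :=
  ⨅ (R : ℝ) (_ : 0 ≤ R ∧ ∃ g : (Fin ℓ → A) → (Fin ℓ → B), Measurable g ∧
      (∃ s : Finset (Fin ℓ → B), s.card ≤ ⌊Real.exp (ℓ * R)⌋₊ ∧ ∀ x, g x ∈ s) ∧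
      (∫⁻ x, (ℓ : ℝ≥0∞)⁻¹ * ∑ i, σ (x i) (g x i) ∂(Measure.pi fun _ : Fin ℓ => μX))
        ≤ ENNReal.ofReal D),
    ENNReal.ofReal R

/-- Beta integral over `(0, 1)`, as an `ℝ≥0∞`-valued integral. -/
lemma lintegral_rpow_mul_one_sub_rpow {a b : ℝ} (ha : 0 < a) (hb : 0 < b) :
    ∫⁻ t in Set.Ioo (0 : ℝ) 1, ENNReal.ofReal (t ^ (a - 1) * (1 - t) ^ (b - 1)) =
      ENNReal.ofReal (ProbabilityTheory.beta a b) := by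
  have hβ := ProbabilityTheory.beta_pos ha hb
  have h := ProbabilityTheory.lintegral_betaPDF_eq_one ha hb
  rw [ProbabilityTheory.lintegral_betaPDF] at h
  rw [← mul_one (ENNReal.ofReal (ProbabilityTheory.beta a b)), ← h,
    ← lintegral_const_mul' _ _ ENNReal.ofReal_ne_top]
  refine lintegral_congr fun t => ?_
  rw [← ENNReal.ofReal_mul hβ.le]
  congr 1
  field_simp

/-- If `h` satisfies the small-ball bound `P(h < t) ≤ C t ^ q` for `ofReal t < T`, then
the truncated moments of `v - h` of order `r` are bounded by a Beta-type constant
times `v ^ (r + q)`, for `v < T`. -/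
lemma lintegral_tsub_rpow_le {A : Type*} [MeasurableSpace A] (P : Measure A)
    {h : A → ℝ≥0∞} (hh : Measurable h) {T : ℝ≥0∞} {C q r : ℝ} (hC : 0 ≤ C) (hq : 0 < q)
    (hr : 0 < r)
    (hP : ∀ t : ℝ, 0 < t → ENNReal.ofReal t < T →
      P {x | h x < ENNReal.ofReal t} ≤ ENNReal.ofReal (C * t ^ q))
    {v : ℝ≥0∞} (hv : v < T) :
    ∫⁻ x, (v - h x) ^ r ∂P ≤
      ENNReal.ofReal (C * (Real.Gamma (1 + q) * Real.Gamma (1 + r) / Real.Gamma (1 + r + q))) *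
        v ^ (r + q) := by
  have hvtop : v ≠ ∞ := (hv.trans_le le_top).ne
  rcases eq_or_ne v 0 with rfl | hv0
  · simp [ENNReal.zero_rpow_of_pos hr]
  obtain ⟨w, rfl⟩ : ∃ w : ℝ, v = ENNReal.ofReal w :=
    ⟨v.toReal, (ENNReal.ofReal_toReal hvtop).symm⟩
  have hw : 0 < w := by simpa using hv0
  set f : A → ℝ := fun x => (ENNReal.ofReal w - h x).toReal / w with hf
  have hfm : Measurable f := by fun_prop
  have hfnn : ∀ x, 0 ≤ f x := fun x => by positivity
  have hpt : ∀ x, (ENNReal.ofReal w - h x) ^ r =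
      ENNReal.ofReal (w ^ r) * ENNReal.ofReal (f x ^ r) := by
    intro x
    have hne : ENNReal.ofReal w - h x ≠ ∞ := ne_top_of_le_ne_top ENNReal.ofReal_ne_top tsub_le_self
    rw [← ENNReal.ofReal_mul (by positivity), ← Real.mul_rpow hw.le (hfnn x), hf]
    simp only
    rw [mul_div_cancel₀ _ hw.ne', ← ENNReal.ofReal_rpow_of_nonneg ENNReal.toReal_nonneg hr.le,
      ENNReal.ofReal_toReal hne]
  have hlevel : ∀ t, 0 < t → P {x | t < f x} ≤
      (Set.Ioo (0 : ℝ) 1).indicator (fun t => ENNReal.ofReal (C * (w * (1 - t)) ^ q)) t := by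
    intro t ht
    have hsub : {x | t < f x} ⊆ {x | h x < ENNReal.ofReal (w * (1 - t))} := by
      intro x hx
      simp only [Set.mem_ofPred_eq, hf] at hx ⊢
      rw [lt_div_iff₀ hw] at hx
      have h1 : ENNReal.ofReal (t * w) < ENNReal.ofReal w - h x :=
        (ENNReal.ofReal_lt_iff_lt_toReal (by positivity)
          (ne_top_of_le_ne_top ENNReal.ofReal_ne_top tsub_le_self)).2 hx
      have h2 := lt_tsub_iff_left.1 h1
      have : w * (1 - t) = w - t * w := by ring
      rw [this, ENNReal.ofReal_sub _ (by positivity)]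
      exact lt_tsub_iff_right.2 h2
    by_cases ht1 : t < 1
    · rw [Set.indicator_of_mem (Set.mem_Ioo.2 ⟨ht, ht1⟩)]
      refine (measure_mono hsub).trans (hP _ (mul_pos hw (by linarith)) ?_)
      refine (ENNReal.ofReal_le_ofReal ?_).trans_lt hv
      nlinarith
    · have : {x | h x < ENNReal.ofReal (w * (1 - t))} = ∅ := by
        rw [ENNReal.ofReal_of_nonpos (by nlinarith)]; simp
      rw [this, Set.subset_empty_iff] at hsub
      simp [hsub]
  simp_rw [hpt]
  rw [lintegral_const_mul' _ _ ENNReal.ofReal_ne_top,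
    lintegral_rpow_eq_lintegral_meas_lt_mul P (Filter.Eventually.of_forall hfnn) hfm.aemeasurable
      hr]
  have hint : ∫⁻ t in Set.Ioi (0 : ℝ), P {x | t < f x} * ENNReal.ofReal (t ^ (r - 1)) ≤
      ENNReal.ofReal (C * w ^ q) * ENNReal.ofReal (ProbabilityTheory.beta r (1 + q)) := by
    rw [← lintegral_rpow_mul_one_sub_rpow hr (by linarith),
      ← lintegral_const_mul' _ _ ENNReal.ofReal_ne_top]
    calc _ ≤ ∫⁻ t in Set.Ioi (0 : ℝ), (Set.Ioo (0 : ℝ) 1).indicator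
            (fun t => ENNReal.ofReal (C * w ^ q) *
              ENNReal.ofReal (t ^ (r - 1) * (1 - t) ^ (1 + q - 1))) t := by
          refine setLIntegral_mono' measurableSet_Ioi fun t ht => ?_
          refine (mul_le_mul_left (hlevel t ht) _).trans ?_
          by_cases ht1 : t ∈ Set.Ioo (0 : ℝ) 1
          · have h1 : 0 ≤ 1 - t := by linarith [ht1.2]
            have h0 : 0 ≤ t := ht1.1.le
            rw [Set.indicator_of_mem ht1, Set.indicator_of_mem ht1,
              ← ENNReal.ofReal_mul (by positivity), ← ENNReal.ofReal_mul (by positivity),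
              Real.mul_rpow hw.le h1, add_sub_cancel_left]
            apply le_of_eq; congr 1; ring
          · rw [Set.indicator_of_notMem ht1]; simp
      _ ≤ _ := by
          rw [lintegral_indicator measurableSet_Ioo,
            Measure.restrict_restrict measurableSet_Ioo]
          exact lintegral_mono_set Set.inter_subset_left
  calc _ ≤ ENNReal.ofReal (w ^ r) * (ENNReal.ofReal r * (ENNReal.ofReal (C * w ^ q) *
          ENNReal.ofReal (ProbabilityTheory.beta r (1 + q)))) := by gcongr
    _ = _ := by
      have hβ := ProbabilityTheory.beta_pos hr (by linarith : 0 < 1 + q)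
      have hG := Real.Gamma_pos_of_pos (by linarith : 0 < 1 + r + q)
      have hG1 := Real.Gamma_pos_of_pos (by linarith : 0 < 1 + r)
      have hG2 := Real.Gamma_pos_of_pos (by linarith : 0 < 1 + q)
      rw [ENNReal.ofReal_rpow_of_pos hw, ← ENNReal.ofReal_mul (by positivity),
        ← ENNReal.ofReal_mul (by positivity), ← ENNReal.ofReal_mul (by positivity),
        ← ENNReal.ofReal_mul (by positivity), Real.rpow_add hw, ProbabilityTheory.beta,
        add_comm 1 r, Real.Gamma_add_one hr.ne', show r + (1 + q) = r + 1 + q by ring]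
      congr 1
      ring

/-- Truncated moments of `v - ∑ i, h i (x i)` for independent coordinates satisfying a
common small-ball bound. -/
lemma lintegral_pi_tsub_sum_rpow_le {A : Type*} [MeasurableSpace A] (P : Measure A)
    [IsProbabilityMeasure P] {T : ℝ≥0∞} {C q : ℝ} (hC : 0 ≤ C) (hq : 0 < q) (n : ℕ)
    {h : Fin n → A → ℝ≥0∞} (hh : ∀ i, Measurable (h i))
    (hP : ∀ i, ∀ t : ℝ, 0 < t → ENNReal.ofReal t < T →
      P {x | h i x < ENNReal.ofReal t} ≤ ENNReal.ofReal (C * t ^ q))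
    {r : ℝ} (hr : 0 < r) {v : ℝ≥0∞} (hv : v < T) :
    ∫⁻ x, (v - ∑ i, h i (x i)) ^ r ∂(Measure.pi fun _ : Fin n => P) ≤
      ENNReal.ofReal ((C * Real.Gamma (1 + q)) ^ n *
          (Real.Gamma (1 + r) / Real.Gamma (1 + r + n * q))) * v ^ (r + n * q) := by
  induction n generalizing r v with
  | zero =>
    have := (Real.Gamma_pos_of_pos (by linarith : 0 < 1 + r)).ne'
    simp [this]
  | succ n ih =>
    have hmp := (measurePreserving_piFinSuccAbove (fun _ : Fin (n + 1) => P) 0).symm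
    have hmeas : Measurable fun x : Fin (n + 1) → A => (v - ∑ i, h i (x i)) ^ r := by
      have := fun i => (hh i).comp (measurable_pi_apply (X := fun _ : Fin (n + 1) => A) i)
      have h2 := Finset.measurable_sum Finset.univ fun i _ => this i
      simp only [Function.comp_def] at h2
      fun_prop
    have hG := Real.Gamma_pos_of_pos (by linarith : 0 < 1 + q)
    have hGr := Real.Gamma_pos_of_pos (by linarith : 0 < 1 + r)
    have hGrq := Real.Gamma_pos_of_pos (by linarith : 0 < 1 + r + q)
    have hGrn := Real.Gamma_pos_of_pos (by positivity : 0 < 1 + (r + q) + n * q)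
    calc _ = ∫⁻ y, ∫⁻ x, ((v - ∑ i : Fin n, h i.succ (y i)) - h 0 x) ^ r ∂P
            ∂(Measure.pi fun _ : Fin n => P) := by
          rw [← hmp.lintegral_comp hmeas]
          refine (lintegral_prod_symm _ (hmeas.comp hmp.measurable).aemeasurable).trans ?_
          refine lintegral_congr fun y => lintegral_congr fun x => ?_
          rw [← tsub_add_eq_tsub_tsub_swap]
          simp [MeasurableEquiv.piFinSuccAbove_symm_apply, Fin.insertNthEquiv, Fin.sum_univ_succ]
      _ ≤ ∫⁻ y, ENNReal.ofReal
            (C * (Real.Gamma (1 + q) * Real.Gamma (1 + r) / Real.Gamma (1 + r + q))) *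
            (v - ∑ i : Fin n, h i.succ (y i)) ^ (r + q) ∂(Measure.pi fun _ : Fin n => P) :=
          lintegral_mono fun y => lintegral_tsub_rpow_le P (hh 0) hC hq hr (hP 0)
            (tsub_le_self.trans_lt hv)
      _ ≤ ENNReal.ofReal
            (C * (Real.Gamma (1 + q) * Real.Gamma (1 + r) / Real.Gamma (1 + r + q))) *
            (ENNReal.ofReal ((C * Real.Gamma (1 + q)) ^ n *
              (Real.Gamma (1 + (r + q)) / Real.Gamma (1 + (r + q) + n * q))) *
              v ^ (r + q + n * q)) := by
          rw [lintegral_const_mul' _ _ ENNReal.ofReal_ne_top]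
          gcongr
          exact ih (fun i => hh i.succ) (fun i => hP i.succ) (by linarith) hv
      _ = _ := by
          rw [← mul_assoc, ← ENNReal.ofReal_mul (by positivity)]
          have e : r + q + n * q = r + (n + 1 : ℕ) * q := by push_cast; ring
          have e' : 1 + (r + q) + n * q = 1 + r + (n + 1 : ℕ) * q := by push_cast; ring
          rw [e', ← add_assoc, e]
          congr 2
          field_simp
          ring

lemma lpNormENN_ofReal {X : Type*} [MeasurableSpace X] (μ : Measure X) (f : X → ℝ≥0∞) {q : ℝ}
    (hq : 0 ≤ q) : lpNormENN μ f (ENNReal.ofReal q) = (∫⁻ x, f x ^ q ∂μ) ^ (1 / q) := by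
  simp [lpNormENN, ENNReal.toReal_ofReal hq]

/-- Hölder's inequality for the measure of a set in terms of the density. -/
lemma measure_le_measure_rpow_mul_lpNormENN {A : Type*} [MeasurableSpace A]
    (μ ν : Measure A) [SigmaFinite μ] [SigmaFinite ν] (hac : ν ≪ μ) {p : ℝ} (hp : 1 ≤ p)
    {E : Set A} (hE : MeasurableSet E) :
    ν E ≤ μ E ^ (1 / p) * lpNormENN μ (ν.rnDeriv μ) (conjExp p) := by
  rw [← Measure.setLIntegral_rnDeriv hac E]
  rcases hp.eq_or_lt with rfl | hp
  · have : lpNormENN μ (ν.rnDeriv μ) (conjExp 1) = essSup (ν.rnDeriv μ) μ := by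
      simp [lpNormENN, conjExp]
    rw [this, div_one, ENNReal.rpow_one, mul_comm, ← setLIntegral_const]
    exact lintegral_mono_ae (ae_restrict_of_ae (ENNReal.ae_le_essSup _))
  · have hpq := Real.HolderConjugate.conjExponent hp
    have hc : conjExp p = ENNReal.ofReal p.conjExponent := by
      rw [conjExp, if_neg hp.ne', Real.conjExponent]
    rw [hc, lpNormENN_ofReal _ _ hpq.symm.nonneg]
    have := ENNReal.lintegral_mul_le_Lp_mul_Lq μ hpq (f := E.indicator 1) (g := ν.rnDeriv μ)
      (measurable_one.indicator hE).aemeasurable (Measure.measurable_rnDeriv _ _).aemeasurable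
    have e1 : ∫⁻ a, ((E.indicator 1 : A → ℝ≥0∞) * ν.rnDeriv μ) a ∂μ =
        ∫⁻ a in E, ν.rnDeriv μ a ∂μ := by
      rw [← lintegral_indicator hE]
      refine lintegral_congr fun a => ?_
      by_cases ha : a ∈ E <;> simp [ha]
    have e2 : ∫⁻ a, (E.indicator (1 : A → ℝ≥0∞) a) ^ p ∂μ = μ E := by
      rw [← lintegral_indicator_one hE]
      refine lintegral_congr fun a => ?_
      by_cases ha : a ∈ E <;> simp [ha, hpq.pos]
    rwa [e1, e2] at this

/-- A lower bound on the expected value of a function that is pointwise one of finitely many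
sums of independent terms satisfying a common small-ball bound. -/
lemma ofReal_le_lintegral_add_card_mul {A B : Type*} [MeasurableSpace A] (P : Measure A)
    [IsProbabilityMeasure P] {T : ℝ≥0∞} {C q : ℝ} (hC : 0 ≤ C) (hq : 0 < q) {n : ℕ}
    {h : A → B → ℝ≥0∞} (hh : ∀ y, Measurable fun x => h x y)
    (hP : ∀ y, ∀ t : ℝ, 0 < t → ENNReal.ofReal t < T →
      P {x | h x y < ENNReal.ofReal t} ≤ ENNReal.ofReal (C * t ^ q))
    {g : (Fin n → A) → Fin n → B} (s : Finset (Fin n → B)) (hg : ∀ x, g x ∈ s)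
    {v : ℝ≥0∞} (hv : v < T) :
    v ≤ (∫⁻ x, ∑ i, h (x i) (g x i) ∂(Measure.pi fun _ : Fin n => P)) +
      s.card * (ENNReal.ofReal ((C * Real.Gamma (1 + q)) ^ n / Real.Gamma (2 + n * q)) *
        v ^ (1 + n * q)) := by
  have hm : ∀ y : Fin n → B, Measurable fun x : Fin n → A => v - ∑ i, h (x i) (y i) := by
    intro y
    have h1 := fun i => (hh (y i)).comp (measurable_pi_apply (X := fun _ : Fin n => A) i)
    have h2 := Finset.measurable_sum Finset.univ fun i _ => h1 i
    simp only [Function.comp_def] at h2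
    fun_prop
  calc v = ∫⁻ _, v ∂(Measure.pi fun _ : Fin n => P) := by simp
    _ ≤ ∫⁻ x, ((∑ i, h (x i) (g x i)) + ∑ y ∈ s, (v - ∑ i, h (x i) (y i)))
          ∂(Measure.pi fun _ : Fin n => P) := by
        refine lintegral_mono fun x => (le_add_tsub (b := ∑ i, h (x i) (g x i))).trans ?_
        gcongr
        exact Finset.single_le_sum (f := fun y => v - ∑ i, h (x i) (y i))
          (fun _ _ => zero_le) (hg x)
    _ = (∫⁻ x, ∑ i, h (x i) (g x i) ∂(Measure.pi fun _ : Fin n => P)) +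
          ∑ y ∈ s, ∫⁻ x, (v - ∑ i, h (x i) (y i)) ∂(Measure.pi fun _ : Fin n => P) := by
        rw [lintegral_add_right _ (Finset.measurable_sum _ fun y _ => hm y),
          lintegral_finsetSum _ fun y _ => hm y]
    _ ≤ _ := by
        gcongr
        rw [← nsmul_eq_mul]
        refine Finset.sum_le_card_nsmul _ _ _ fun y _ => ?_
        have := lintegral_pi_tsub_sum_rpow_le P hC hq n (h := fun i x => h x (y i))
          (fun i => hh (y i)) (fun i => hP (y i)) one_pos hv
        simpa [one_add_one_eq_two, Real.Gamma_two, mul_one_div, div_eq_mul_inv] using this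

/-- Lower bound on the length-`ℓ` operational rate-distortion function
of an i.i.d. source: if `μ` is σ-finite, `μ_{X₁} ≪ μ` with
`Σ_p = ‖dμ_{X₁}/dμ‖_{p/(p-1)}^{(μ)} < ∞`, and `μ` is `σ^{1/k}`-subregular of dimension
`m` with constants `c, δ₀`, then for all `D ∈ (0, D_{(ℓ)})`,
`R_{(ℓ)}(D) ≥ (m/(pk))·log(ℓm/((ℓm+pk)·D)) − log d_{(ℓ)}`. -/
theorem operational_rate_lower_bound
    {A B : Type*} [MeasurableSpace A] [MeasurableSpace B]
    (μ : Measure A) [SigmaFinite μ] (μX : Measure A) [IsProbabilityMeasure μX]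
    (hac : μX ≪ μ)
    (σ : A → B → ℝ≥0∞) (hσ : Measurable (Function.uncurry σ))
    (p : ℝ) (hp : 1 ≤ p)
    (hSig : lpNormENN μ (μX.rnDeriv μ) (conjExp p) < ∞)
    (k m c : ℝ) (δ₀ : ℝ≥0∞) (hk : 0 < k) (hm : 0 < m) (hc : 0 < c) (hδ₀ : 0 < δ₀)
    (hsub : ∀ y : B, ∀ t : ℝ, 0 < t → ENNReal.ofReal t < δ₀ →
      μ {x | (σ x y) ^ (1 / k) < ENNReal.ofReal t} ≤ ENNReal.ofReal (c * t ^ m))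
    (ℓ : ℕ) (hℓ : 0 < ℓ) :
    ∀ D : ℝ, 0 < D →
      ENNReal.ofReal D < δ₀ ^ k * ENNReal.ofReal ((1 / ℓ) * (ℓ * m / (ℓ * m + p * k))) →
      ENNReal.ofReal
          ((m / (p * k)) * Real.log (ℓ * m / ((ℓ * m + p * k) * D))
            - Real.log
                ((Real.Gamma (1 + m / (p * k)) * (ℓ : ℝ) ^ (m / (p * k))
                    / Real.Gamma (1 + ℓ * m / (p * k)) ^ (1 / (ℓ : ℝ)))
                  * c ^ (1 / p) * (lpNormENN μ (μX.rnDeriv μ) (conjExp p)).toReal)) ≤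
        opRate μX σ ℓ D := by
  intro D hD hDlt
  set S := lpNormENN μ (μX.rnDeriv μ) (conjExp p) with hS
  have hp0 : 0 < p := by linarith
  have hL : (0 : ℝ) < ℓ := by exact_mod_cast hℓ
  set q := m / (p * k) with hq_def
  have hq : 0 < q := by positivity
  set C := c ^ (1 / p) * S.toReal with hC_def
  have hC : 0 ≤ C := by positivity
  have hσm : ∀ y, Measurable fun x => σ x y := fun y => hσ.comp measurable_prodMk_right
  have hball : ∀ y, ∀ t : ℝ, 0 < t → ENNReal.ofReal t < δ₀ ^ k →
      μX {x | σ x y < ENNReal.ofReal t} ≤ ENNReal.ofReal (C * t ^ q) := by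
    intro y t ht htδ
    have hkk : (1 : ℝ) / k = k⁻¹ := one_div k
    have h1 := hsub y (t ^ k⁻¹) (by positivity) (by
      rw [← ENNReal.ofReal_rpow_of_pos ht]
      exact (ENNReal.rpow_inv_lt_iff hk).2 htδ)
    have h2 : {x | σ x y ^ (1 / k) < ENNReal.ofReal (t ^ k⁻¹)} =
        {x | σ x y < ENNReal.ofReal t} := by
      ext x
      rw [Set.mem_ofPred_eq, Set.mem_ofPred_eq, ← ENNReal.ofReal_rpow_of_pos ht, hkk,
        ENNReal.rpow_lt_rpow_iff (by positivity)]
    rw [h2] at h1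
    refine (measure_le_measure_rpow_mul_lpNormENN μ μX hac hp
      (measurableSet_lt (hσm y) measurable_const)).trans ?_
    rw [← hS]
    calc _ ≤ ENNReal.ofReal (c * (t ^ k⁻¹) ^ m) ^ (1 / p) * S := by gcongr
      _ = _ := by
        rw [ENNReal.ofReal_rpow_of_nonneg (by positivity) (by positivity)]
        nth_rw 1 [← ENNReal.ofReal_toReal hSig.ne]
        rw [← ENNReal.ofReal_mul (by positivity), Real.mul_rpow hc.le (by positivity),
          ← Real.rpow_mul ht.le, ← Real.rpow_mul ht.le, hC_def,
          show k⁻¹ * m * (1 / p) = q by rw [hq_def]; field_simp]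
        congr 1
        ring
  set b := ℓ * q with hb_def
  have hb : 0 < b := by positivity
  set u := ℓ * D * ((b + 1) / b) with hu_def
  have hu : 0 < u := by positivity
  have hratio : ℓ * m / (ℓ * m + p * k) = b / (b + 1) := by
    rw [hb_def, hq_def]; field_simp
  have huδ : ENNReal.ofReal u < δ₀ ^ k := by
    rw [hratio] at hDlt
    have h1 : u = D / (1 / ℓ * (b / (b + 1))) := by rw [hu_def]; field_simp
    rw [h1, ENNReal.ofReal_div_of_pos (by positivity)]
    exact ENNReal.div_lt_of_lt_mul hDlt
  have hGq := Real.Gamma_pos_of_pos (by linarith : 0 < 1 + q)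
  have hGb := Real.Gamma_pos_of_pos (by linarith : 0 < 1 + b)
  refine le_iInf₂ fun R ⟨hR, g, hg, ⟨s, hscard, hgs⟩, hdist⟩ => ENNReal.ofReal_le_ofReal ?_
  have hsum : ∫⁻ x, ∑ i, σ (x i) (g x i) ∂(Measure.pi fun _ : Fin ℓ => μX) ≤
      ENNReal.ofReal (ℓ * D) := by
    rw [lintegral_const_mul' _ _ (by simp [hℓ.ne'])] at hdist
    rw [ENNReal.ofReal_mul hL.le, ENNReal.ofReal_natCast]
    rwa [← ENNReal.div_le_iff' (by simp [hℓ.ne']) (by simp), div_eq_mul_inv, mul_comm]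
  have hN : (s.card : ℝ) ≤ Real.exp (ℓ * R) :=
    (Nat.cast_le.2 hscard).trans (Nat.floor_le (Real.exp_pos _).le)
  have hkey : u ≤ ℓ * D + Real.exp (ℓ * R) *
      ((C * Real.Gamma (1 + q)) ^ ℓ / Real.Gamma (2 + b) * u ^ (1 + b)) := by
    have hG2 := Real.Gamma_pos_of_pos (by linarith : 0 < 2 + b)
    have h1 := ofReal_le_lintegral_add_card_mul μX hC hq hσm hball s hgs huδ
    rw [← hb_def, ENNReal.ofReal_rpow_of_pos hu, ← ENNReal.ofReal_mul (by positivity),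
      ← ENNReal.ofReal_natCast, ← ENNReal.ofReal_mul (by positivity)] at h1
    replace h1 := h1.trans (add_le_add_left hsum _)
    rw [← ENNReal.ofReal_add (by positivity) (by positivity),
      ENNReal.ofReal_le_ofReal_iff (by positivity)] at h1
    refine h1.trans ?_
    gcongr
  have hone : 1 ≤ Real.exp (ℓ * R) *
      ((C * Real.Gamma (1 + q)) ^ ℓ / Real.Gamma (1 + b) * u ^ b) := by
    have hG2 : Real.Gamma (2 + b) = (1 + b) * Real.Gamma (1 + b) := by
      rw [← Real.Gamma_add_one (by positivity)]; congr 1; ring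
    rw [hG2, Real.rpow_add hu, Real.rpow_one] at hkey
    have hLD : ℓ * D = u * (b / (b + 1)) := by rw [hu_def]; field_simp
    rw [hLD] at hkey
    have h2 : u * (b / (b + 1)) + Real.exp (ℓ * R) *
        ((C * Real.Gamma (1 + q)) ^ ℓ / ((1 + b) * Real.Gamma (1 + b)) * (u * u ^ b)) =
        u / (b + 1) * (b + Real.exp (ℓ * R) *
          ((C * Real.Gamma (1 + q)) ^ ℓ / Real.Gamma (1 + b) * u ^ b)) := by
      field_simp
      ring
    rw [h2, div_mul_eq_mul_div, le_div_iff₀ (by positivity)] at hkey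
    have := le_of_mul_le_mul_left hkey hu
    linarith
  have hCpos : 0 < C := by
    refine hC.lt_of_ne' fun h0 => ?_
    rw [h0, zero_mul, zero_pow hℓ.ne'] at hone
    norm_num at hone
  have hlog := Real.log_nonneg hone
  rw [Real.log_mul (by positivity) (by positivity), Real.log_exp,
    Real.log_mul (by positivity) (by positivity), Real.log_div (by positivity) (by positivity),
    Real.log_pow, Real.log_mul hCpos.ne' hGq.ne', Real.log_rpow hu] at hlog
  have e1 : ℓ * m / ((ℓ * m + p * k) * D) = ℓ / u := by
    rw [← div_div, hratio, hu_def]; field_simp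
  have e2 : 1 + ℓ * m / (p * k) = 1 + b := by rw [hb_def, hq_def]; ring
  rw [e1, e2, mul_assoc _ (c ^ (1 / p)), ← hC_def, Real.log_div hL.ne' hu.ne',
    Real.log_mul (by positivity) hCpos.ne', Real.log_div (by positivity) (by positivity),
    Real.log_mul hGq.ne' (by positivity), Real.log_rpow hL, Real.log_rpow hGb]
  refine le_of_mul_le_mul_left ?_ hL
  have e3 : ℓ * (1 / (ℓ : ℝ) * Real.log (Real.Gamma (1 + b))) = Real.log (Real.Gamma (1 + b)) := by
    field_simp
  rw [hb_def] at hlog e3 ⊢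
  linarith
end
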